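/- For any quasi-topological group G, the coordinate maps of EG, namely t_i : EG → [0,1], [(t_j,g_j)]_j ↦ t_i, and g_i : t_i⁻¹((0,1]) → G, [(t_j,g_j)]_j ↦ g_i (where t_i⁻¹((0,1]) carries the subspace quasi-topology), are quasi-continuous for every i ∈ ℕ. -/

import Mathlib

/-! Statement 10: for any quasi-topological group `G`, the coordinate maps
`t_i : EG → [0,1]` and `g_i : t_i⁻¹((0,1]) → G` are quasi-continuous. -/

universe u v w

/-- A family of "admissible" maps from compact Hausdorff test spaces into `X`. -/
def QFam (X : Type w) := ∀ K : CompHaus.{0}, Set (K → X)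

/-- A quasi-topological space structure (Spanier): axioms (Q1)–(Q4). -/
structure QuasiTop (X : Type w) where
  Q : QFam X
  const_mem : ∀ (K : CompHaus.{0}) (x : X), (fun _ : K => x) ∈ Q K
  precomp_mem : ∀ (K₁ K₂ : CompHaus.{0}) (f : K₁ → K₂), Continuous f →
    ∀ ψ ∈ Q K₂, ψ ∘ f ∈ Q K₁
  surj_mem : ∀ (K₁ K₂ : CompHaus.{0}) (f : K₁ → K₂), Continuous f → Function.Surjective f →
    ∀ ψ : K₂ → X, ψ ∘ f ∈ Q K₁ → ψ ∈ Q K₂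
  sum_mem : ∀ (K₁ K₂ : CompHaus.{0}) (ψ : (CompHaus.of ((K₁ : Type) ⊕ (K₂ : Type))) → X),
    ψ ∘ Sum.inl ∈ Q K₁ → ψ ∘ Sum.inr ∈ Q K₂ → ψ ∈ Q (CompHaus.of ((K₁ : Type) ⊕ (K₂ : Type)))

/-- Quasi-continuity of a map relative to given families of admissible maps. -/
def QuasiContinuous {X : Type w} {Y : Type v} (qX : QFam X) (qY : QFam Y) (f : X → Y) : Prop :=
  ∀ (K : CompHaus.{0}) (φ : K → X), φ ∈ qX K → f ∘ φ ∈ qY K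

/-- The quasi-topology of a topological space. -/
def topQ (Z : Type w) [TopologicalSpace Z] : QFam Z := fun _K => {φ | Continuous φ}

/-- The quotient quasi-topology induced by a surjection `π : X → Y`. -/
def quotientQ {X : Type w} {Y : Type v} (qX : QFam X) (π : X → Y) : QFam Y :=
  fun K => {φ | ∃ (K' : CompHaus.{0}) (π' : K' → K) (φ' : K' → X),
    Continuous π' ∧ Function.Surjective π' ∧ φ' ∈ qX K' ∧ π ∘ φ' = φ ∘ π'}

/-- The product quasi-topology. -/
def prodQ {ι : Type*} {X : ι → Type*} (q : ∀ i, QFam (X i)) : QFam (∀ i, X i) :=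
  fun K => {φ | ∀ i, (fun k => φ k i) ∈ q i K}

/-- The binary product quasi-topology. -/
def prod2Q {X Y : Type*} (qX : QFam X) (qY : QFam Y) : QFam (X × Y) :=
  fun K => {φ | (fun k => (φ k).1) ∈ qX K ∧ (fun k => (φ k).2) ∈ qY K}

/-- The subspace quasi-topology. -/
def subspaceQ {X : Type*} (q : QFam X) (S : Set X) : QFam S :=
  fun K => {φ | (fun k => (φ k : X)) ∈ q K}

/-- Completely Hausdorff quasi-topological space. -/
def QCompletelyHausdorff {X : Type*} (q : QFam X) : Prop :=
  ∀ x y : X, x ≠ y → ∃ f : X → unitInterval,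
    QuasiContinuous q (topQ unitInterval) f ∧ f x = 0 ∧ f y = 1

/-- A quasi-topological group: multiplication and inversion are quasi-continuous. -/
structure QuasiTopGroup (G : Type w) [Group G] (qG : QuasiTop G) : Prop where
  mul_qc : QuasiContinuous (prod2Q qG.Q qG.Q) qG.Q (fun p => p.1 * p.2)
  inv_qc : QuasiContinuous qG.Q qG.Q (fun g => g⁻¹)

/-- The setoid on `X × [0,1]` collapsing `X × {0}` to a point. -/
def coneSetoid (X : Type w) : Setoid (X × unitInterval) where
  r a b := a = b ∨ (a.2 = 0 ∧ b.2 = 0)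
  iseqv := by
    refine ⟨fun a => Or.inl rfl, ?_, ?_⟩
    · rintro a b (rfl | ⟨h1, h2⟩)
      · exact Or.inl rfl
      · exact Or.inr ⟨h2, h1⟩
    · rintro a b c (rfl | ⟨h1, h2⟩) h
      · exact h
      · rcases h with rfl | ⟨h3, h4⟩
        · exact Or.inr ⟨h1, h2⟩
        · exact Or.inr ⟨h1, h4⟩

/-- The unreduced cone of `X`, as a set: `(X × [0,1])/(X × {0})`. -/
def Cone (X : Type w) := Quotient (coneSetoid X)

/-- The canonical quotient map `X × [0,1] → con(X)`. -/
def conePt {X : Type w} (p : X × unitInterval) : Cone X := Quotient.mk (coneSetoid X) p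

/-- The quotient quasi-topology on the cone, induced from the product quasi-topology
on `X × [0,1]`. -/
def coneQ {X : Type w} (q : QFam X) : QFam (Cone X) :=
  quotientQ (prod2Q q (topQ unitInterval)) conePt

/-- The coordinate map `t : con(X) → [0,1]`, `[(x, s)] ↦ s`. -/
def coneT {X : Type w} : Cone X → unitInterval :=
  Quotient.lift (fun p => p.2) fun _a _b h =>
    Or.elim h (fun h => by rw [h]) (fun h => h.1.trans h.2.symm)

/-- The coordinate map `x : t⁻¹((0,1]) → X`, `[(x, s)] ↦ x`. -/
noncomputable def coneX {X : Type w} (c : {c : Cone X // coneT c ≠ 0}) : X :=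
  (Quotient.out c.1).1

/-- The underlying set of the (modified) Milnor space `EG`:
sequences `[(t_j, g_j)]_j` in `con(G)^ℕ` with `Σ_j t_j = 1`. -/
def EGSet (G : Type w) : Set (ℕ → Cone G) :=
  {e | HasSum (fun j => (coneT (e j) : ℝ)) 1}

/-- The quasi-topology of `EG`: subspace of the product quasi-topology on `con(G)^ℕ`. -/
def egQ {G : Type w} (q : QFam G) : QFam (EGSet G) :=
  subspaceQ (prodQ fun _ : ℕ => coneQ q) (EGSet G)

/-- The coordinate map `t_i : EG → [0,1]`. -/
def egT {G : Type w} (i : ℕ) (e : EGSet G) : unitInterval := coneT (e.1 i)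

/-- The coordinate map `g_i : t_i⁻¹((0,1]) → G`. -/
noncomputable def egG {G : Type w} (i : ℕ) (e : {e : EGSet G // egT i e ≠ 0}) : G :=
  coneX ⟨e.1.1 i, e.2⟩

theorem quasiContinuous_coneT {X : Type w} (q : QFam X) :
    QuasiContinuous (coneQ q) (topQ unitInterval) coneT := by
  rintro K φ ⟨K', π', φ', hc, hs, hφ', h⟩
  have hquot : Topology.IsQuotientMap π' := hc.isClosedMap.isQuotientMap hc hs
  have heq : (coneT ∘ φ) ∘ π' = fun k => (φ' k).2 := by
    funext k
    exact (congrArg coneT (congrFun h k)).symm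
  change Continuous (coneT ∘ φ)
  rw [hquot.continuous_iff, heq]
  exact hφ'.2

theorem coneX_eq_fst {X : Type w} (c : {c : Cone X // coneT c ≠ 0}) (p : X × unitInterval)
    (h : conePt p = c.1) : coneX c = p.1 := by
  have hout : conePt (Quotient.out c.1) = c.1 := Quotient.out_eq c.1
  rcases Quotient.exact (hout.trans h.symm) with heq | ⟨_, hp⟩
  · exact congrArg Prod.fst heq
  · exact absurd ((congrArg coneT h).symm.trans hp) c.2

theorem quasiContinuous_coneX {X : Type w} (q : QuasiTop X) :
    QuasiContinuous (subspaceQ (coneQ q.Q) {c | coneT c ≠ 0}) q.Q coneX := by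
  rintro K φ ⟨K', π', φ', hc, hs, hφ', h⟩
  refine q.surj_mem K' K π' hc hs _ ?_
  have heq : (coneX ∘ φ) ∘ π' = fun k => (φ' k).1 := by
    funext k
    exact coneX_eq_fst (φ (π' k)) (φ' k) (congrFun h k)
  exact heq ▸ hφ'.1

theorem stmt_10 {G : Type u} [Group G] (qG : QuasiTop G) (hG : QuasiTopGroup G qG) (i : ℕ) :
    QuasiContinuous (egQ qG.Q) (topQ unitInterval) (egT i) ∧
    QuasiContinuous (subspaceQ (egQ qG.Q) {e | egT i e ≠ 0}) qG.Q
      (fun e => egG i e) := by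
  exact ⟨fun K φ hφ => quasiContinuous_coneT qG.Q K (fun k => (φ k).1 i) (hφ i),
    fun K φ hφ => quasiContinuous_coneX qG K (fun k => ⟨(φ k).1.1 i, (φ k).2⟩) (hφ i)⟩
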